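/- Let ~β ∈ ℝ, ~γ > 0, p > 0, and let ω, ~ρ be probability measures on ℝ with ω ⊳ ~ρ ⊞-infinitely divisible. Define μ = (ω ⊳ ~ρ)^{⊞(1/p)}, μ_t = μ^{⊞t}, and ~μ_t = δ_{~βt} ⊎ Φ[~ρ ⊞ ω^{⊞(t/p)}]^{⊎~γt}, i.e. z − F_{~μ_t}(z) = ~β t + ~γ t · G_{~ρ ⊞ ω^{⊞(t/p)}}(z). Then ~μ_1 has finite non-zero variance, the family {(~μ_t, μ_t) : t ≥ 0} is a two-state free convolution semigroup, and for every t > 0, J[~μ_t] = ~ρ ⊞ ω^{⊞(t/p)}. -/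

import Mathlib

open MeasureTheory Complex

noncomputable section

/-- The Cauchy transform `G_μ(z) = ∫ 1/(z - x) dμ(x)` of a measure on `ℝ`. -/
def cauchyG (μ : Measure ℝ) (z : ℂ) : ℂ := ∫ x : ℝ, (z - (x : ℂ))⁻¹ ∂μ

/-- The F-transform `F_μ = 1/G_μ`. -/
def Ftr (μ : Measure ℝ) (z : ℂ) : ℂ := (cauchyG μ z)⁻¹

/-- The open upper half-plane `ℂ⁺`. -/
def UHP : Set ℂ := {z : ℂ | 0 < z.im}

/-- The truncated cone `Γ_{α,M} = {z ∈ ℂ⁺ : |Re z| < α · Im z, Im z > M}`. -/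
def tcone (α M : ℝ) : Set ℂ := {z : ℂ | |z.re| < α * z.im ∧ M < z.im}

/-- `φ` is a Voiculescu transform of `μ`: `φ(F_μ(z)) + F_μ(z) = z` on some truncated cone. -/
def IsVT (μ : Measure ℝ) (φ : ℂ → ℂ) : Prop :=
  ∃ α M : ℝ, 0 < α ∧ 0 < M ∧ ∀ z ∈ tcone α M, φ (Ftr μ z) + Ftr μ z = z

/-- `ψ` is a two-state Voiculescu transform of the pair `(μt, μ)`:
`ψ(F_μ(z)) + F_{μt}(z) = z` on some truncated cone. -/
def IsTwoStateVT (μt μ : Measure ℝ) (ψ : ℂ → ℂ) : Prop :=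
  ∃ α M : ℝ, 0 < α ∧ 0 < M ∧ ∀ z ∈ tcone α M, ψ (Ftr μ z) + Ftr μt z = z

/-- `μ` is freely infinitely divisible: some Voiculescu transform `φ` of `μ` is such that
`t·φ` is a Voiculescu transform of a probability measure for every `t ≥ 0`. -/
def IsFID (μ : Measure ℝ) : Prop :=
  ∃ φ : ℂ → ℂ, IsVT μ φ ∧ ∀ t : ℝ, 0 ≤ t →
    ∃ ν : Measure ℝ, IsProbabilityMeasure ν ∧ IsVT ν (fun z => (t : ℂ) * φ z)

/-- The semicircular distribution with mean `β` and variance `γ` (Dirac mass at `β` for `γ = 0`). -/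
def semicircle (β γ : ℝ) : Measure ℝ :=
  if γ = 0 then Measure.dirac β
  else volume.withDensity
    (fun x => ENNReal.ofReal ((2 * Real.pi * γ)⁻¹ * Real.sqrt (4 * γ - (x - β) ^ 2)))

open Filter Topology

lemma sub_ofReal_ne_zero {z : ℂ} (hz : z ∈ UHP) (x : ℝ) : z - x ≠ 0 := by
  intro h
  have : z.im = 0 := by simpa using congrArg Complex.im h
  exact (ne_of_gt hz) this

lemma norm_inv_sub_ofReal_le {z : ℂ} (hz : z ∈ UHP) (x : ℝ) : ‖(z - (x : ℂ))⁻¹‖ ≤ z.im⁻¹ := by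
  have hz' : 0 < z.im := hz
  rw [norm_inv]
  refine inv_anti₀ hz' ?_
  simpa [abs_of_pos hz'] using Complex.abs_im_le_norm (z - x)

lemma continuous_inv_sub_ofReal {z : ℂ} (hz : z ∈ UHP) :
    Continuous fun x : ℝ => (z - (x : ℂ))⁻¹ :=
  (continuous_const.sub Complex.continuous_ofReal).inv₀ (sub_ofReal_ne_zero hz)

lemma integrable_inv_sub_ofReal (μ : Measure ℝ) [IsFiniteMeasure μ] {z : ℂ} (hz : z ∈ UHP) :
    Integrable (fun x : ℝ => (z - (x : ℂ))⁻¹) μ :=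
  Integrable.of_bound (continuous_inv_sub_ofReal hz).aestronglyMeasurable _
    (Eventually.of_forall (norm_inv_sub_ofReal_le hz))

lemma cauchyG_im_nonpos (μ : Measure ℝ) [IsFiniteMeasure μ] {z : ℂ} (hz : z ∈ UHP) :
    (cauchyG μ z).im ≤ 0 := by
  have hz' : 0 < z.im := hz
  have h := Complex.imCLM.integral_comp_comm (integrable_inv_sub_ofReal μ hz)
  simp only [Complex.imCLM_apply] at h
  rw [cauchyG, ← h]
  refine integral_nonpos fun x => ?_
  simp only [Complex.inv_im, Complex.sub_im, Complex.ofReal_im, sub_zero, Pi.zero_apply]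
  exact div_nonpos_of_nonpos_of_nonneg (by linarith) (Complex.normSq_nonneg _)

lemma sub_sub_mul_ne_zero {z g : ℂ} (hz : z ∈ UHP) (hg : g.im ≤ 0) (β : ℝ) {γ : ℝ} (hγ : 0 ≤ γ) :
    z - β - γ * g ≠ 0 := by
  have hz' : 0 < z.im := hz
  intro h
  have h2 : z.im - γ * g.im = 0 := by simpa using congrArg Complex.im h
  nlinarith [mul_nonneg hγ (neg_nonneg.2 hg)]

lemma differentiableAt_cauchyG (μ : Measure ℝ) [IsFiniteMeasure μ] {z : ℂ} (hz : z ∈ UHP) :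
    DifferentiableAt ℂ (cauchyG μ) z := by
  have h : cauchyG μ = fun a : ℂ => -resolventTransform μ a := by
    funext a
    rw [cauchyG, resolventTransform_apply, ← integral_neg]
    refine integral_congr_ae (Eventually.of_forall fun x => ?_)
    simp [resolvent, Ring.inverse_eq_inv', ← inv_neg]
  rw [h]
  refine (hasDerivAt_resolventTransform z ?_).differentiableAt.neg
  rintro ⟨x, -, rfl⟩
  exact (sub_ofReal_ne_zero hz x) (by simp)

/-- The spectral measure of a symmetric operator on a finite-dimensional space at a unit vector. -/
lemma exists_spectral_measure {E : Type*} [NormedAddCommGroup E] [InnerProductSpace ℂ E]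
    [FiniteDimensional ℂ E] {T : E →ₗ[ℂ] E} (hT : T.IsSymmetric) {e : E} (he : ‖e‖ = 1) :
    ∃ μ : Measure ℝ, IsProbabilityMeasure μ ∧
      ∫⁻ x, ENNReal.ofReal (x ^ 2) ∂μ = ENNReal.ofReal (‖T e‖ ^ 2) ∧
      ∀ z ∈ UHP, ∀ u : E, z • u - T u = e → cauchyG μ z = inner ℂ e u := by
  set b := hT.eigenvectorBasis rfl with hb
  set ev := hT.eigenvalues rfl with hev
  have hTb : ∀ i, T (b i) = (ev i : ℂ) • b i := hT.apply_eigenvectorBasis rfl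
  have hinner : ∀ i v, inner ℂ (b i) (T v) = (ev i : ℂ) * inner ℂ (b i) v := fun i v => by
    rw [← hT, hTb, inner_smul_left, Complex.conj_ofReal]
  refine ⟨∑ i, ENNReal.ofReal (‖inner ℂ (b i) e‖ ^ 2) • Measure.dirac (ev i), ⟨?_⟩, ?_, ?_⟩
  · simp only [Measure.coe_finsetSum, Finset.sum_apply, Measure.smul_apply, measure_univ,
      smul_eq_mul, mul_one]
    rw [← ENNReal.ofReal_sum_of_nonneg (fun _ _ => by positivity),
      b.sum_sq_norm_inner_right, he]
    simp
  · rw [lintegral_finsetSum_measure]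
    simp only [lintegral_smul_measure, lintegral_dirac, smul_eq_mul]
    simp only [← ENNReal.ofReal_mul (sq_nonneg _)]
    rw [← ENNReal.ofReal_sum_of_nonneg (fun _ _ => by positivity),
      ← b.sum_sq_norm_inner_right (T e)]
    congr 1
    refine Finset.sum_congr rfl fun i _ => ?_
    rw [hinner, norm_mul, mul_pow, Complex.norm_real, Real.norm_eq_abs, sq_abs, mul_comm]
  · intro z hz u hu
    rw [cauchyG, integral_finsetSum_measure]
    · rw [← b.sum_inner_mul_inner e u]
      refine Finset.sum_congr rfl fun i _ => ?_
      rw [integral_smul_measure, integral_dirac, ENNReal.toReal_ofReal (sq_nonneg _)]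
      have h1 : (z - ev i) * inner ℂ (b i) u = inner ℂ (b i) e := by
        rw [← hu, inner_sub_right, inner_smul_right, hinner]
        ring
      have h2 : inner ℂ (b i) u = (z - ev i)⁻¹ * inner ℂ (b i) e := by
        rw [← h1, inv_mul_cancel_left₀ (sub_ofReal_ne_zero hz _)]
      rw [h2, ← inner_conj_symm e (b i), Complex.real_smul, mul_left_comm, Complex.conj_mul',
        mul_comm]
      push_cast
      rfl
    · intro i _
      exact (integrable_inv_sub_ofReal (Measure.dirac (ev i)) hz).smul_measure ENNReal.ofReal_ne_top

lemma exists_cauchyG_eq_of_fintype {ι : Type*} [Fintype ι] (x w : ι → ℝ) (hw : ∀ i, 0 ≤ w i)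
    (β : ℝ) {γ : ℝ} (hγ : 0 ≤ γ) :
    ∃ μ : Measure ℝ, IsProbabilityMeasure μ ∧
      ∫⁻ x, ENNReal.ofReal (x ^ 2) ∂μ = ENNReal.ofReal (β ^ 2 + γ * ∑ i, w i) ∧
      ∀ z ∈ UHP, cauchyG μ z = (z - β - γ * ∑ i, w i * (z - x i)⁻¹)⁻¹ := by
  classical
  let A : Matrix (Option ι) (Option ι) ℂ := fun i j =>
    match i, j with
    | none, none => (β : ℂ)
    | none, some j => ((√(γ * w j) : ℝ) : ℂ)
    | some i, none => ((√(γ * w i) : ℝ) : ℂ)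
    | some i, some j => if i = j then (x i : ℂ) else 0
  have h00 : A none none = β := rfl
  have h0s : ∀ j, A none (some j) = ((√(γ * w j) : ℝ) : ℂ) := fun _ => rfl
  have hs0 : ∀ i, A (some i) none = ((√(γ * w i) : ℝ) : ℂ) := fun _ => rfl
  have hss : ∀ i j, A (some i) (some j) = if i = j then (x i : ℂ) else 0 := fun _ _ => rfl
  clear_value A
  have hA : A.IsHermitian := by
    refine Matrix.IsHermitian.ext fun i j => ?_
    rcases i with _ | i <;> rcases j with _ | j
    · simp [h00]
    · simp [h0s, hs0]
    · simp [h0s, hs0]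
    · rcases eq_or_ne i j with rfl | h
      · simp [hss]
      · simp [hss, h, h.symm]
  have hs : ∀ i, ((√(γ * w i) : ℝ) : ℂ) * ((√(γ * w i) : ℝ) : ℂ) = γ * w i := fun i => by
    rw [← Complex.ofReal_mul, Real.mul_self_sqrt (mul_nonneg hγ (hw i))]
    push_cast
    rfl
  have hT : (Matrix.toEuclideanLin A).IsSymmetric := Matrix.isSymmetric_toEuclideanLin_iff.2 hA
  have hTa : ∀ v i, Matrix.toEuclideanLin A v i = A i none * v none + ∑ j, A i (some j) * v (some j) :=
    fun v i => Fintype.sum_option _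
  let e : EuclideanSpace ℂ (Option ι) := EuclideanSpace.single none 1
  have he : ‖e‖ = 1 := by simp [e]
  have he0 : e none = 1 := by simp [e]
  have hes : ∀ i, e (some i) = 0 := by simp [e]
  obtain ⟨μ, hμ, hm, hG⟩ := exists_spectral_measure hT he
  refine ⟨μ, hμ, ?_, fun z hz => ?_⟩
  · rw [hm]
    congr 1
    rw [EuclideanSpace.norm_sq_eq, Fintype.sum_option, Finset.mul_sum]
    congr 1
    · simp [hTa, h00, he0, hes]
    · refine Finset.sum_congr rfl fun i _ => ?_
      simp [hTa, hs0, he0, hes, Real.sq_sqrt (mul_nonneg hγ (hw i))]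
  · have hgim : (∑ i, (w i : ℂ) * (z - x i)⁻¹).im ≤ 0 := by
      rw [Complex.im_sum]
      refine Finset.sum_nonpos fun i _ => ?_
      have hz' : 0 < z.im := hz
      simp only [Complex.im_ofReal_mul, Complex.inv_im, Complex.sub_im, Complex.ofReal_im, sub_zero]
      exact mul_nonpos_of_nonneg_of_nonpos (hw i)
        (div_nonpos_of_nonpos_of_nonneg (by linarith) (Complex.normSq_nonneg _))
    have hne := sub_sub_mul_ne_zero hz hgim β hγ
    set D := (z - β - γ * ∑ i, w i * (z - x i)⁻¹)⁻¹ with hD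
    let u : EuclideanSpace ℂ (Option ι) := WithLp.toLp 2 fun i =>
      match i with
      | none => D
      | some i => ((√(γ * w i) : ℝ) : ℂ) * (z - x i)⁻¹ * D
    have hu0 : u none = D := rfl
    have hus : ∀ i, u (some i) = ((√(γ * w i) : ℝ) : ℂ) * (z - x i)⁻¹ * D := fun _ => rfl
    clear_value u
    rw [hG z hz u]
    · simp [e, hu0, EuclideanSpace.inner_single_left]
    · ext i
      rw [PiLp.sub_apply, PiLp.smul_apply, hTa, smul_eq_mul, hu0]
      rcases i with _ | i
      · have h3 : ∑ i, ((√(γ * w i) : ℝ) : ℂ) * (((√(γ * w i) : ℝ) : ℂ) * (z - x i)⁻¹ * D)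
            = γ * (∑ i, w i * (z - x i)⁻¹) * D := by
          rw [Finset.mul_sum, Finset.sum_mul]
          refine Finset.sum_congr rfl fun i _ => ?_
          rw [← mul_assoc, ← mul_assoc, hs]
          ring
        simp only [hu0, hus, h00, h0s, h3, he0]
        rw [← mul_inv_cancel₀ hne, ← hD]
        ring
      · have := sub_ofReal_ne_zero hz (x i)
        simp only [hus, hs0, hss, hes, ite_mul, zero_mul, Finset.sum_ite_eq, Finset.mem_univ,
          if_true]
        field_simp
        ring

lemma integral_comp_simpleFunc {α F : Type*} [MeasurableSpace α] [NormedAddCommGroup F]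
    [NormedSpace ℝ F] [CompleteSpace F] {β : Type*} (ν : Measure α) [IsFiniteMeasure ν]
    (f : SimpleFunc α β) (g : β → F) :
    ∫ a, g (f a) ∂ν = ∑ y : f.range, ν.real (f ⁻¹' {(y : β)}) • g y := by
  classical
  have h : ∀ a, g (f a) = ∑ y : f.range, (f ⁻¹' {(y : β)}).indicator (fun _ => g y) a := fun a => by
    rw [Finset.sum_eq_single ⟨f a, f.mem_range_self a⟩]
    · simp
    · intro y _ hy
      refine Set.indicator_of_notMem (fun hay => hy ?_) _
      exact Subtype.ext (by simpa [eq_comm] using hay)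
    · simp
  simp only [h]
  rw [integral_finsetSum]
  · exact Finset.sum_congr rfl fun y _ => integral_indicator_const _ (f.measurableSet_fiber _)
  · exact fun y _ => (integrable_const (g y)).indicator (f.measurableSet_fiber _)

lemma exists_cauchyG_eq_of_simpleFunc (ν : Measure ℝ) [IsProbabilityMeasure ν]
    (f : SimpleFunc ℝ ℝ) (β : ℝ) {γ : ℝ} (hγ : 0 ≤ γ) :
    ∃ μ : ProbabilityMeasure ℝ,
      ∫⁻ x, ENNReal.ofReal (x ^ 2) ∂(μ : Measure ℝ) = ENNReal.ofReal (β ^ 2 + γ) ∧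
      ∀ z ∈ UHP, cauchyG μ z = (z - β - γ * ∫ x, (z - (f x : ℂ))⁻¹ ∂ν)⁻¹ := by
  obtain ⟨μ, hμ, hm, hG⟩ := exists_cauchyG_eq_of_fintype (fun y : f.range => (y : ℝ))
    (fun y => ν.real (f ⁻¹' {(y : ℝ)})) (fun _ => measureReal_nonneg) β hγ
  have h1 : ∑ y : f.range, ν.real (f ⁻¹' {(y : ℝ)}) = 1 := by
    simpa using (integral_comp_simpleFunc ν f (fun _ => (1 : ℝ))).symm
  refine ⟨⟨μ, hμ⟩, ?_, fun z hz => ?_⟩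
  · rw [h1, mul_one] at hm
    exact hm
  · rw [integral_comp_simpleFunc ν f fun y : ℝ => (z - (y : ℂ))⁻¹]
    simpa using hG z hz

lemma isTightMeasureSet_of_lintegral_sq_le {S : Set (Measure ℝ)} {C : ENNReal} (hC : C ≠ ⊤)
    (h : ∀ μ ∈ S, ∫⁻ x, ENNReal.ofReal (x ^ 2) ∂μ ≤ C) : IsTightMeasureSet S := by
  refine isTightMeasureSet_of_tendsto_measure_norm_gt ?_
  have hlim : Tendsto (fun r : ℝ => C / ENNReal.ofReal (r ^ 2)) atTop (𝓝 0) :=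
    ENNReal.Tendsto.const_div
      (ENNReal.tendsto_ofReal_atTop.comp (tendsto_pow_atTop two_ne_zero)) (Or.inr hC)
      |>.trans (by simp)
  refine tendsto_of_tendsto_of_tendsto_of_le_of_le' tendsto_const_nhds hlim
    (Eventually.of_forall fun _ => zero_le) ?_
  filter_upwards [eventually_gt_atTop 0] with r hr
  refine iSup₂_le fun μ hμ => ?_
  have h2 : μ {x | ENNReal.ofReal (r ^ 2) ≤ ENNReal.ofReal (x ^ 2)} ≤
      (∫⁻ x, ENNReal.ofReal (x ^ 2) ∂μ) / ENNReal.ofReal (r ^ 2) :=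
    meas_ge_le_lintegral_div (by fun_prop) (by simpa using hr.ne') ENNReal.ofReal_ne_top
  refine le_trans (measure_mono fun x hx => ?_) (h2.trans (ENNReal.div_le_div_right (h μ hμ) _))
  refine ENNReal.ofReal_le_ofReal ?_
  rw [← sq_abs x]
  exact pow_le_pow_left₀ hr.le (le_of_lt hx) 2

/-- `(z - β - γ G_ν(z))⁻¹` is the Cauchy transform of a probability measure with finite variance. -/
lemma exists_cauchyG_eq (ν : Measure ℝ) [IsProbabilityMeasure ν] (β : ℝ) {γ : ℝ} (hγ : 0 ≤ γ) :
    ∃ μ : Measure ℝ, IsProbabilityMeasure μ ∧ Integrable (fun x : ℝ => x ^ 2) μ ∧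
      ∀ z ∈ UHP, cauchyG μ z = (z - β - γ * cauchyG ν z)⁻¹ := by
  have hid : StronglyMeasurable (id : ℝ → ℝ) := stronglyMeasurable_id
  choose μ hm hG using fun n => exists_cauchyG_eq_of_simpleFunc ν (hid.approx n) β hγ
  have hcomp : IsCompact (closure (Set.range μ)) := by
    refine isCompact_closure_of_isTightMeasureSet
      (isTightMeasureSet_of_lintegral_sq_le (C := ENNReal.ofReal (β ^ 2 + γ))
        ENNReal.ofReal_ne_top ?_)
    rintro _ ⟨_, ⟨n, rfl⟩, rfl⟩
    exact (hm n).le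
  obtain ⟨μ', -, φ, hφ, hlim⟩ := hcomp.tendsto_subseq fun n => subset_closure ⟨n, rfl⟩
  refine ⟨μ', inferInstance, ?_, fun z hz => ?_⟩
  · have hfin : ∫⁻ x, ENNReal.ofReal (x ^ 2) ∂(μ' : Measure ℝ) ≤ ENNReal.ofReal (β ^ 2 + γ) := by
      refine (lintegral_le_liminf_lintegral_of_forall_isOpen_measure_le_liminf_measure
        (by fun_prop) (fun x => sq_nonneg x)
        fun G hGo => ProbabilityMeasure.le_liminf_measure_open_of_tendsto hlim hGo).trans ?_
      simp [hm]
    exact (lintegral_ofReal_ne_top_iff_integrable (by fun_prop)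
      (Eventually.of_forall fun x => sq_nonneg x)).1
        (ne_top_of_le_ne_top ENNReal.ofReal_ne_top hfin)
  · let g : BoundedContinuousFunction ℝ ℂ := BoundedContinuousFunction.ofNormedAddCommGroup
      (fun x : ℝ => (z - (x : ℂ))⁻¹) (continuous_inv_sub_ofReal hz) _ (norm_inv_sub_ofReal_le hz)
    have h1 : Tendsto (fun n => cauchyG (μ (φ n)) z) atTop (𝓝 (cauchyG μ' z)) :=
      (ProbabilityMeasure.tendsto_iff_forall_integral_rclike_tendsto ℂ).1 hlim g
    have h2 : Tendsto (fun n => ∫ x, (z - (hid.approx n x : ℂ))⁻¹ ∂ν) atTop (𝓝 (cauchyG ν z)) := by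
      refine tendsto_integral_of_dominated_convergence (fun _ => z.im⁻¹) (fun n => ?_)
        (integrable_const _) (fun n => Eventually.of_forall fun x => norm_inv_sub_ofReal_le hz _)
        (Eventually.of_forall fun x => ?_)
      · exact ((continuous_inv_sub_ofReal hz).measurable.comp
          (hid.approx n).measurable).aestronglyMeasurable
      · exact ((continuous_inv_sub_ofReal hz).tendsto x).comp (hid.tendsto_approx x)
    have h3 : Tendsto (fun n => cauchyG (μ (φ n)) z) atTop
        (𝓝 (z - β - γ * cauchyG ν z)⁻¹) := by
      simp only [hG _ z hz]
      exact ((tendsto_const_nhds.sub ((h2.comp hφ.tendsto_atTop).const_mul _)).inv₀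
        (sub_sub_mul_ne_zero hz (cauchyG_im_nonpos ν hz) β hγ))
    exact tendsto_nhds_unique h1 h3

/-- The filter of nontangential neighbourhoods of infinity in the upper half-plane, with arbitrarily
narrow aperture. -/
def ntInfty : Filter ℂ :=
  comap (fun z : ℂ => z.re / z.im) (𝓝 0) ⊓ comap Complex.im atTop

lemma mem_ntInfty {S : Set ℂ} :
    S ∈ ntInfty ↔ ∃ α M : ℝ, 0 < α ∧ 0 < M ∧ tcone α M ⊆ S := by
  have hb := ((nhds_basis_abs_sub_lt (0 : ℝ)).comap fun z : ℂ => z.re / z.im).inf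
    ((atTop_basis_Ioi' (0 : ℝ)).comap Complex.im)
  have hset : ∀ α M : ℝ, 0 < M → (fun z : ℂ => z.re / z.im) ⁻¹' {x | |x - 0| < α} ∩
      Complex.im ⁻¹' Set.Ioi M = tcone α M := by
    intro α M hM
    ext z
    simp only [tcone, Set.mem_inter_iff, Set.mem_preimage, Set.mem_ofPred_eq, Set.mem_Ioi, sub_zero]
    refine and_congr_left fun h => ?_
    have hz : 0 < z.im := hM.trans h
    rw [abs_div, abs_of_pos hz, div_lt_iff₀ hz]
  rw [ntInfty, hb.mem_iff]
  constructor
  · rintro ⟨⟨α, M⟩, ⟨hα, hM⟩, h⟩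
    exact ⟨α, M, hα, hM, (hset α M hM) ▸ h⟩
  · rintro ⟨α, M, hα, hM, h⟩
    exact ⟨⟨α, M⟩, ⟨hα, hM⟩, (hset α M hM).symm ▸ h⟩

lemma eventually_ntInfty {P : ℂ → Prop} :
    (∀ᶠ z in ntInfty, P z) ↔ ∃ α M : ℝ, 0 < α ∧ 0 < M ∧ ∀ z ∈ tcone α M, P z :=
  mem_ntInfty

lemma eventually_mem_UHP : ∀ᶠ z in ntInfty, z ∈ UHP :=
  eventually_ntInfty.2 ⟨1, 1, one_pos, one_pos, fun _ hz => one_pos.trans hz.2⟩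

/-- Neighbourhoods of infinity in the cone `|Re z| ≤ Im z`. -/
def coneInfty : Filter ℂ :=
  comap Complex.im atTop ⊓ 𝓟 {z : ℂ | |z.re| ≤ z.im}

lemma eventually_coneInfty {P : ℂ → Prop} :
    (∀ᶠ z in coneInfty, P z) ↔ ∃ M : ℝ, 0 < M ∧ ∀ z : ℂ, |z.re| ≤ z.im → M < z.im → P z := by
  have hb := ((atTop_basis_Ioi' (0 : ℝ)).comap Complex.im).inf_principal {z : ℂ | |z.re| ≤ z.im}
  rw [coneInfty, hb.eventually_iff]
  exact exists_congr fun M => and_congr_right fun _ =>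
    ⟨fun h z h1 h2 => h ⟨h2, h1⟩, fun h z hz => h z hz.2 hz.1⟩


lemma tendsto_inv_coneInfty : Tendsto (fun z : ℂ => z⁻¹) coneInfty (𝓝 0) := by
  have him : Tendsto Complex.im coneInfty atTop := tendsto_comap.mono_left inf_le_left
  refine squeeze_zero_norm' ?_ him.inv_tendsto_atTop
  filter_upwards [him.eventually_gt_atTop 0] with z hz
  rw [norm_inv]
  exact inv_anti₀ hz ((le_abs_self _).trans (Complex.abs_im_le_norm z))

lemma norm_le_two_mul_im {z : ℂ} (h : |z.re| ≤ z.im) : ‖z‖ ≤ 2 * z.im := by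
  have := Complex.norm_le_abs_re_add_abs_im z
  rw [abs_of_nonneg ((abs_nonneg _).trans h)] at this
  linarith

lemma tendsto_mul_cauchyG (μ : Measure ℝ) [IsProbabilityMeasure μ] :
    Tendsto (fun z => z * cauchyG μ z) coneInfty (𝓝 1) := by
  have : coneInfty.IsCountablyGenerated := by unfold coneInfty; infer_instance
  have hev : ∀ᶠ z in coneInfty, z ∈ UHP ∧ |z.re| ≤ z.im :=
    eventually_coneInfty.2 ⟨1, one_pos, fun z h1 h2 => ⟨one_pos.trans h2, h1⟩⟩
  have h : Tendsto (fun z : ℂ => ∫ x : ℝ, z * (z - (x : ℂ))⁻¹ ∂μ) coneInfty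
      (𝓝 (∫ _ : ℝ, (1 : ℂ) ∂μ)) := by
    refine tendsto_integral_filter_of_dominated_convergence (fun _ => 2) ?_ ?_
      (integrable_const _) (Eventually.of_forall fun x => ?_)
    · filter_upwards [hev] with z hz
      exact (continuous_const.mul (continuous_inv_sub_ofReal hz.1)).aestronglyMeasurable
    · filter_upwards [hev] with z hz
      refine Eventually.of_forall fun x => ?_
      have hz' : 0 < z.im := hz.1
      calc ‖z * (z - (x : ℂ))⁻¹‖ ≤ (2 * z.im) * z.im⁻¹ := by
            rw [norm_mul]
            exact mul_le_mul (norm_le_two_mul_im hz.2) (norm_inv_sub_ofReal_le hz.1 x)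
              (norm_nonneg _) (by positivity)
        _ = 2 := mul_inv_cancel_right₀ hz'.ne' 2
    · have h1 : Tendsto (fun z : ℂ => (1 - x * z⁻¹)⁻¹) coneInfty (𝓝 1) := by
        simpa using (tendsto_const_nhds.sub (tendsto_inv_coneInfty.const_mul (x : ℂ))).inv₀
          (by simp : (1 : ℂ) - x * 0 ≠ 0)
      refine h1.congr' ?_
      filter_upwards [hev] with z hz
      have hz0 : z ≠ 0 := by simpa using sub_ofReal_ne_zero hz.1 0
      rw [← inv_inj, inv_inv, mul_inv, inv_inv, mul_sub, inv_mul_cancel₀ hz0, mul_comm z⁻¹]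
  simpa [cauchyG, integral_const_mul] using h

lemma exists_norm_Ftr_sub_le (μ : Measure ℝ) [IsProbabilityMeasure μ] {ε : ℝ} (hε : 0 < ε) :
    ∃ M : ℝ, 0 < M ∧ ∀ z : ℂ, |z.re| ≤ z.im → M < z.im →
      cauchyG μ z ≠ 0 ∧ ‖Ftr μ z - z‖ ≤ ε * ‖z‖ := by
  rw [← eventually_coneInfty]
  have h := tendsto_mul_cauchyG μ
  have h1 : Tendsto (fun z => (z * cauchyG μ z)⁻¹) coneInfty (𝓝 1) := by
    simpa using h.inv₀ one_ne_zero
  filter_upwards [h.eventually_ne one_ne_zero, Metric.tendsto_nhds.1 h1 ε hε] with z h2 h3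
  have hz := left_ne_zero_of_mul h2
  refine ⟨right_ne_zero_of_mul h2, ?_⟩
  have h4 : Ftr μ z - z = ((z * cauchyG μ z)⁻¹ - 1) * z := by
    rw [Ftr, mul_inv, sub_mul, mul_right_comm, inv_mul_cancel₀ hz, one_mul, one_mul]
  rw [h4, norm_mul, ← dist_eq_norm]
  exact mul_le_mul_of_nonneg_right h3.le (norm_nonneg _)

lemma abs_re_im_sub_le {z w : ℂ} {r : ℝ} (h : ‖w - z‖ ≤ r) :
    |w.re| ≤ |z.re| + r ∧ z.im - r ≤ w.im := by
  have h1 := (Complex.abs_re_le_norm (w - z)).trans h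
  have h2 := (Complex.abs_im_le_norm (w - z)).trans h
  rw [Complex.sub_re] at h1
  rw [Complex.sub_im] at h2
  constructor
  · linarith [abs_sub_abs_le_abs_sub w.re z.re]
  · linarith [(abs_le.1 h2).1]

lemma tendsto_Ftr_ntInfty (μ : Measure ℝ) [IsProbabilityMeasure μ] :
    Tendsto (Ftr μ) ntInfty ntInfty := by
  intro S hS
  obtain ⟨α, M, hα, hM, h⟩ := mem_ntInfty.1 hS
  set a := min α 1
  have ha : 0 < a := lt_min hα one_pos
  have ha1 : a ≤ 1 := min_le_right _ _
  obtain ⟨K, hK, hF⟩ := exists_norm_Ftr_sub_le μ (ε := a / 16) (by positivity)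
  refine mem_ntInfty.2 ⟨a / 4, max K (2 * M), by positivity, hK.trans_le (le_max_left _ _),
    fun z hz => h ?_⟩
  have hz1 : K < z.im := (le_max_left _ _).trans_lt hz.2
  have hz2 : 2 * M < z.im := (le_max_right _ _).trans_lt hz.2
  have hz0 : 0 < z.im := hK.trans hz1
  have hre : |z.re| < a / 4 * z.im := hz.1
  have hcone : |z.re| ≤ z.im := by nlinarith
  obtain ⟨h1, h2⟩ := abs_re_im_sub_le ((hF z hcone hz1).2.trans
    (mul_le_mul_of_nonneg_left (norm_le_two_mul_im hcone) (by positivity)))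
  have h4 : 3 / 4 * z.im ≤ (Ftr μ z).im := by nlinarith
  have h5 : a * (3 / 4 * z.im) ≤ α * (Ftr μ z).im :=
    mul_le_mul (min_le_left _ _) h4 (by positivity) hα.le
  exact ⟨by nlinarith, by linarith⟩

lemma DiffContOnCl.mem_image_closedBall_of_norm_sub_le {f : ℂ → ℂ} {w : ℂ} {r : ℝ} (hr : 0 < r)
    (hf : DiffContOnCl ℂ f (Metric.ball w r)) (hs : ∀ z ∈ Metric.sphere w r, r / 2 ≤ ‖f z - f w‖)
    (hw : ‖f w - w‖ < r / 4) : w ∈ f '' Metric.closedBall w r := by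
  refine hf.ball_subset_image_closedBall hr hs ?_ ?_
  · intro hev
    simp only [ne_eq, not_not] at hev
    have h1 : Set.EqOn f (fun _ => f w) (Metric.ball w r) :=
      (hf.differentiableOn.analyticOnNhd Metric.isOpen_ball).eqOn_of_preconnected_of_eventuallyEq
        analyticOnNhd_const (convex_ball w r).isPreconnected (Metric.mem_ball_self hr) hev
    have h2 : Set.EqOn f (fun _ => f w) (Metric.closedBall w r) :=
      h1.of_subset_closure hf.continuousOn_ball continuousOn_const Metric.ball_subset_closedBall
        (closure_ball w hr.ne').ge
    have hmem : w + r ∈ Metric.sphere w r := by simp [abs_of_pos hr]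
    have h3 := hs _ hmem
    rw [h2 (Metric.sphere_subset_closedBall hmem), sub_self, norm_zero] at h3
    linarith
  · rw [Metric.mem_ball, dist_comm, dist_eq_norm]
    linarith

lemma ntInfty_le_map_Ftr (μ : Measure ℝ) [IsProbabilityMeasure μ] :
    ntInfty ≤ map (Ftr μ) ntInfty := by
  intro S hS
  obtain ⟨α, M, hα, hM, h⟩ := mem_ntInfty.1 (mem_map.1 hS)
  set a := min α 1
  have ha : 0 < a := lt_min hα one_pos
  have ha1 : a ≤ 1 := min_le_right _ _
  obtain ⟨K, hK, hF⟩ := exists_norm_Ftr_sub_le μ (ε := a / 64) (by positivity)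
  refine mem_ntInfty.2 ⟨a / 4, 2 * max K M, by positivity, by positivity, fun w hw => ?_⟩
  have hwK : 2 * K < w.im := (by gcongr; exact le_max_left _ _ : _ ≤ 2 * max K M).trans_lt hw.2
  have hwM : 2 * M < w.im := (by gcongr; exact le_max_right _ _ : _ ≤ 2 * max K M).trans_lt hw.2
  have hw0 : 0 < w.im := by linarith
  have hre : |w.re| < a / 4 * w.im := hw.1
  have hwn : ‖w‖ ≤ 2 * w.im := norm_le_two_mul_im (by nlinarith)
  have hwn0 : 0 < ‖w‖ := hw0.trans_le ((le_abs_self _).trans (Complex.abs_im_le_norm w))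
  set r := a / 8 * ‖w‖ with hr
  have hr0 : 0 < r := by positivity
  have hball : ∀ z ∈ Metric.closedBall w r, |z.re| < a * z.im ∧ w.im ≤ 2 * z.im := by
    intro z hz
    obtain ⟨h1, h2⟩ := abs_re_im_sub_le (mem_closedBall_iff_norm.1 hz)
    have h3 : r ≤ a / 4 * w.im := by rw [hr]; nlinarith
    have h4 : a / 4 * w.im ≤ 1 / 4 * w.im := by gcongr
    have h5 : 3 / 4 * w.im ≤ z.im := by linarith
    refine ⟨?_, by linarith⟩
    calc |z.re| < a * (3 / 4 * w.im) := by nlinarith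
      _ ≤ a * z.im := by gcongr
  have hcone : ∀ z ∈ Metric.closedBall w r, |z.re| ≤ z.im ∧ K < z.im := by
    intro z hz
    obtain ⟨h1, h2⟩ := hball z hz
    exact ⟨by nlinarith, by linarith⟩
  have hw_mem : w ∈ Metric.closedBall w r := Metric.mem_closedBall_self hr0.le
  have hbd : ∀ z ∈ Metric.closedBall w r, ‖Ftr μ z - z‖ ≤ a / 64 * ‖z‖ := fun z hz =>
    (hF z (hcone z hz).1 (hcone z hz).2).2
  have hFw := hbd w hw_mem
  have hdiff : ∀ z ∈ Metric.closedBall w r, DifferentiableAt ℂ (Ftr μ) z := fun z hz =>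
    (differentiableAt_cauchyG μ (hK.trans (hcone z hz).2)).inv (hF z (hcone z hz).1 (hcone z hz).2).1
  have hsph : ∀ z ∈ Metric.sphere w r, r / 2 ≤ ‖Ftr μ z - Ftr μ w‖ := by
    intro z hz
    have hz' := Metric.sphere_subset_closedBall hz
    have hzr : ‖z - w‖ = r := mem_sphere_iff_norm.1 hz
    have h1 := hbd z hz'
    have h2 : ‖z‖ ≤ 2 * ‖w‖ := by
      have h6 : ‖z‖ ≤ ‖w‖ + ‖z - w‖ := by simpa using norm_add_le w (z - w)
      nlinarith
    have h3 : a / 64 * ‖z‖ ≤ a / 64 * (2 * ‖w‖) := by gcongr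
    have h4 : ‖z - w‖ ≤ ‖Ftr μ z - Ftr μ w‖ + ‖Ftr μ z - z‖ + ‖Ftr μ w - w‖ := by
      have : z - w = (Ftr μ z - Ftr μ w) - (Ftr μ z - z) + (Ftr μ w - w) := by ring
      calc ‖z - w‖ = ‖(Ftr μ z - Ftr μ w) - (Ftr μ z - z) + (Ftr μ w - w)‖ := by rw [← this]
        _ ≤ _ := (norm_add_le _ _).trans (by gcongr; exact norm_sub_le _ _)
    linarith
  obtain ⟨z, hz, hzw⟩ := DiffContOnCl.mem_image_closedBall_of_norm_sub_le (f := Ftr μ) hr0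
    (DifferentiableOn.diffContOnCl fun z hz =>
      (hdiff z (Metric.closure_ball_subset_closedBall hz)).differentiableWithinAt) hsph
    (by linarith)
  rw [← hzw]
  refine h ⟨(hball z hz).1.trans_le ?_, by linarith [(hball z hz).2]⟩
  exact mul_le_mul_of_nonneg_right (min_le_left _ _) (hK.trans (hcone z hz).2).le

lemma isVT_iff {μ : Measure ℝ} {φ : ℂ → ℂ} :
    IsVT μ φ ↔ ∀ᶠ z in ntInfty, φ (Ftr μ z) + Ftr μ z = z :=
  eventually_ntInfty.symm

lemma isTwoStateVT_iff {μt μ : Measure ℝ} {ψ : ℂ → ℂ} :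
    IsTwoStateVT μt μ ψ ↔ ∀ᶠ z in ntInfty, ψ (Ftr μ z) + Ftr μt z = z :=
  eventually_ntInfty.symm

/-- If `φ` is a Voiculescu transform of the subordination distribution `ω ⊳ ρ`, then
`φ = φ_ω ∘ F_ρ` near infinity. -/
lemma eventually_voiculescu_subordination {ρ conv sub : Measure ℝ} [IsProbabilityMeasure sub]
    {φω φρ φs : ℂ → ℂ} (hφρ : IsVT ρ φρ) (hconv : IsVT conv fun z => φω z + φρ z)
    (hsub : ∀ z ∈ UHP, cauchyG conv z = cauchyG ρ (Ftr sub z)) (hφs : IsVT sub φs) :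
    ∀ᶠ w in ntInfty, φs w = φω (Ftr ρ w) := by
  refine ntInfty_le_map_Ftr sub (eventually_map.2 ?_)
  filter_upwards [(tendsto_Ftr_ntInfty sub).eventually (isVT_iff.1 hφρ), isVT_iff.1 hconv,
    isVT_iff.1 hφs, eventually_mem_UHP] with z h1 h2 h3 hz
  have h4 : Ftr conv z = Ftr ρ (Ftr sub z) := by rw [Ftr, hsub z hz, ← Ftr]
  rw [h4] at h2
  linear_combination h3 - h2 + h1

/-- Subordination for convolution powers: `ρ ⊞ ω^{⊞s}` is subordinate to `ρ` through
`(ω ⊳ ρ)^{⊞s}`. -/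
lemma eventually_cauchyG_eq_comp_Ftr {ρ σ ν : Measure ℝ} [IsProbabilityMeasure ρ]
    [IsProbabilityMeasure σ] [IsProbabilityMeasure ν] {φω φρ φs : ℂ → ℂ} {s : ℂ}
    (hφρ : IsVT ρ φρ) (hφs : ∀ᶠ w in ntInfty, φs w = φω (Ftr ρ w))
    (hσ : IsVT σ fun z => s * φs z) (hν : IsVT ν fun z => φρ z + s * φω z) :
    ∀ᶠ z in ntInfty, cauchyG ν z = cauchyG ρ (Ftr σ z) := by
  have hinv : ∀ᶠ u in ntInfty, Ftr ν (φρ u + s * φω u + u) = u := by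
    refine ntInfty_le_map_Ftr ν (eventually_map.2 ?_)
    filter_upwards [isVT_iff.1 hν] with z hz
    rw [hz]
  have hσt := tendsto_Ftr_ntInfty σ
  filter_upwards [((tendsto_Ftr_ntInfty ρ).comp hσt).eventually hinv,
    hσt.eventually (isVT_iff.1 hφρ), hσt.eventually hφs, isVT_iff.1 hσ] with z h1 h2 h3 h4
  simp only [Function.comp_apply] at h1
  have h5 : φρ (Ftr ρ (Ftr σ z)) + s * φω (Ftr ρ (Ftr σ z)) + Ftr ρ (Ftr σ z) = z := by
    rw [← h3]
    linear_combination h2 + h4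
  rw [h5] at h1
  exact inv_injective h1

lemma not_forall_cauchyG_eq_const (ν : Measure ℝ) [IsProbabilityMeasure ν] (c : ℂ) :
    ¬ ∀ z ∈ UHP, cauchyG ν z = c := by
  intro h
  have hy : Tendsto (fun y : ℝ => (y : ℂ) * I) atTop coneInfty := by
    refine tendsto_inf.2 ⟨tendsto_comap_iff.2 ?_, tendsto_principal.2 ?_⟩
    · simpa [Function.comp_def] using! tendsto_id
    · filter_upwards [eventually_ge_atTop 0] with y hy
      simpa using hy
  have h1 : Tendsto (fun y : ℝ => (y : ℂ) * I * c) atTop (𝓝 1) := by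
    refine ((tendsto_mul_cauchyG ν).comp hy).congr' ?_
    filter_upwards [eventually_gt_atTop 0] with y hy
    simp only [Function.comp_apply]
    rw [h _ (by simpa [UHP] using hy)]
  have h2 : Tendsto (fun _ : ℝ => c) atTop (𝓝 (0 * 1)) := by
    refine ((tendsto_inv_coneInfty.comp hy).mul h1).congr' ?_
    filter_upwards [eventually_gt_atTop 0] with y hy
    have : (y : ℂ) * I ≠ 0 := by simp [hy.ne']
    simp only [Function.comp_apply]
    rw [← mul_assoc, inv_mul_cancel₀ this, one_mul]
  have hc : c = 0 := by simpa using tendsto_nhds_unique tendsto_const_nhds h2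
  subst hc
  simp only [mul_zero] at h1
  exact zero_ne_one (tendsto_nhds_unique tendsto_const_nhds h1)

lemma exists_Ftr_eq_of_variance_eq_zero {μ : Measure ℝ} [IsProbabilityMeasure μ]
    (hμ : Integrable (fun x : ℝ => x ^ 2) μ)
    (h : ProbabilityTheory.variance (fun x : ℝ => x) μ = 0) :
    ∃ m : ℝ, ∀ z, Ftr μ z = z - m := by
  have hmem : MemLp (fun x : ℝ => x) 2 μ :=
    (memLp_two_iff_integrable_sq measurable_id.aestronglyMeasurable).2 hμ
  have h0 := ((ENNReal.toReal_eq_zero_iff _).1 h).resolve_right hmem.evariance_lt_top.ne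
  rw [ProbabilityTheory.evariance_eq_zero_iff (X := fun x : ℝ => x) aemeasurable_id'] at h0
  refine ⟨∫ x, x ∂μ, fun z => ?_⟩
  rw [Ftr, cauchyG, inv_eq_iff_eq_inv]
  have h1 : (fun x : ℝ => (z - (x : ℂ))⁻¹) =ᵐ[μ] fun _ => (z - ((∫ x, x ∂μ : ℝ) : ℂ))⁻¹ := by
    filter_upwards [h0] with x hx
    rw [← hx]
  rw [integral_congr_ae h1]
  simp

/-- With `ω ⊳ tρ = sub` ⊞-infinitely divisible (powers `subpow`),
`μ_t = sub^{⊞(t/p)} = subpow (t/p)`, and `ν t = tρ ⊞ ω^{⊞(t/p)}` (the measure with Voiculescu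
transform `φ_{tρ} + (t/p)φ_ω`), there is a family `tμ` of probability measures with
`z − F_{tμ_t}(z) = tβ·t + tγ·t·G_{ν t}(z)` (so `J[tμ_t] = tρ ⊞ ω^{⊞(t/p)}`); `tμ 1` has
finite non-zero variance, and `{(tμ t, μ t)}` forms a two-state free convolution semigroup. -/
theorem stmt7
    (tβ tγ p : ℝ) (htγ : 0 < tγ) (hp : 0 < p)
    (ω tρ : Measure ℝ) (hω : IsProbabilityMeasure ω) (htρ : IsProbabilityMeasure tρ)
    (φω φρ : ℂ → ℂ) (hφω : IsVT ω φω) (hφρ : IsVT tρ φρ)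
    (conv : Measure ℝ) (hconvprob : IsProbabilityMeasure conv)
    (hconv : IsVT conv (fun z => φω z + φρ z))
    (sub : Measure ℝ) (hsubprob : IsProbabilityMeasure sub)
    (hsubdef : ∀ z ∈ UHP, cauchyG conv z = cauchyG tρ (Ftr sub z))
    (φs : ℂ → ℂ) (hφs : IsVT sub φs)
    (subpow : ℝ → Measure ℝ) (hsp : ∀ s : ℝ, 0 ≤ s → IsProbabilityMeasure (subpow s))
    (hspVT : ∀ s : ℝ, 0 ≤ s → IsVT (subpow s) (fun z => (s : ℂ) * φs z))
    (ν : ℝ → Measure ℝ) (hν : ∀ t : ℝ, 0 ≤ t → IsProbabilityMeasure (ν t))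
    (hνVT : ∀ t : ℝ, 0 ≤ t → IsVT (ν t) (fun z => φρ z + ((t / p : ℝ) : ℂ) * φω z)) :
    ∃ tμ : ℝ → Measure ℝ,
      (∀ t : ℝ, 0 ≤ t → IsProbabilityMeasure (tμ t)) ∧
      (∀ t : ℝ, 0 ≤ t → ∀ z ∈ UHP,
        z - Ftr (tμ t) z = ((tβ * t : ℝ) : ℂ) + ((tγ * t : ℝ) : ℂ) * cauchyG (ν t) z) ∧
      Integrable (fun x : ℝ => x ^ 2) (tμ 1) ∧
      ProbabilityTheory.variance (fun x : ℝ => x) (tμ 1) ≠ 0 ∧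
      (∃ ψ : ℂ → ℂ, ∀ t : ℝ, 0 ≤ t →
        IsTwoStateVT (tμ t) (subpow (t / p)) (fun z => (t : ℂ) * ψ z)) := by
  have hex : ∀ t : ℝ, ∃ μ : Measure ℝ, 0 ≤ t → IsProbabilityMeasure μ ∧
      Integrable (fun x : ℝ => x ^ 2) μ ∧ ∀ z ∈ UHP,
        z - Ftr μ z = ((tβ * t : ℝ) : ℂ) + ((tγ * t : ℝ) : ℂ) * cauchyG (ν t) z := by
    intro t
    by_cases ht : 0 ≤ t
    · have := hν t ht
      obtain ⟨μ, h1, h2, h3⟩ := exists_cauchyG_eq (ν t) (tβ * t) (mul_nonneg htγ.le ht)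
      refine ⟨μ, fun _ => ⟨h1, h2, fun z hz => ?_⟩⟩
      rw [Ftr, h3 z hz, inv_inv]
      ring
    · exact ⟨0, fun h => absurd h ht⟩
  choose tμ htμ using hex
  obtain ⟨hp1, hi1, hF1⟩ := htμ 1 zero_le_one
  refine ⟨tμ, fun t ht => (htμ t ht).1, fun t ht => (htμ t ht).2.2, hi1, fun hvar => ?_,
    fun w => tβ + tγ * cauchyG tρ w, fun t ht => ?_⟩
  · obtain ⟨m, hm⟩ := exists_Ftr_eq_of_variance_eq_zero hi1 hvar
    have := hν 1 zero_le_one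
    refine not_forall_cauchyG_eq_const (ν 1) ((m - tβ) / tγ) fun z hz => ?_
    have h := hF1 z hz
    rw [hm, mul_one, mul_one] at h
    rw [eq_div_iff (Complex.ofReal_ne_zero.2 htγ.ne')]
    linear_combination -h
  · have hs : 0 ≤ t / p := div_nonneg ht hp.le
    have := hν t ht
    have := hsp _ hs
    rw [isTwoStateVT_iff]
    filter_upwards [eventually_mem_UHP, eventually_cauchyG_eq_comp_Ftr hφρ
      (eventually_voiculescu_subordination hφρ hconv hsubdef hφs) (hspVT _ hs) (hνVT t ht)]
      with z hz hG
    have h := (htμ t ht).2.2 z hz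
    rw [hG] at h
    push_cast at h
    linear_combination -h
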